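/- Let u be the variable of the rational function field ℚ(u), set t = 4(u² − 1)/(7u² + 17) ∈ ℚ(u), and let A(t) = 65536t⁴ − 17472t³ − 10176t² + 18672t − 3535, B(t) = 1024(t+1)²(15t−8)²(31t−7)², and X₅ = −64(1+t)²(7t−4)(17t+4)/(1+4t)², all viewed as elements of ℚ(u). Then there exists Y ∈ ℚ(u) such that Y² = X₅³ + A(t)X₅² + B(t)X₅; that is, X₅ is the X-coordinate of a ℚ(u)-rational point on the curve Y² = X³ + A(t)X² + B(t)X over ℚ(u). -/

import Mathlib

/-- The polynomial `7u² + 17` does not vanish in `ℚ(u)`. -/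
lemma seven_mul_X_sq_add_seventeen_ne_zero :
    (7 * RatFunc.X ^ 2 + 17 : RatFunc ℚ) ≠ 0 := by
  have hp : (7 * Polynomial.X ^ 2 + 17 : Polynomial ℚ) ≠ 0 := fun h => by
    simpa using congrArg (Polynomial.eval 0) h
  have h := RatFunc.algebraMap_ne_zero hp
  rwa [map_add, map_mul, map_pow, RatFunc.algebraMap_X, map_ofNat, map_ofNat] at h

/-- The substitution `t = 4(u² - 1)/(7u² + 17)` makes `-(7t - 4)(17t + 4)` a square. -/
lemma sq_eq_of_conic_parametrization {K : Type*} [Field K] (u : K) (hu : 7 * u ^ 2 + 17 ≠ 0) :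
    (96 * u / (7 * u ^ 2 + 17)) ^ 2 =
      -((7 * (4 * (u ^ 2 - 1) / (7 * u ^ 2 + 17)) - 4) *
        (17 * (4 * (u ^ 2 - 1) / (7 * u ^ 2 + 17)) + 4)) := by
  have h₁ : 7 * (4 * (u ^ 2 - 1) / (7 * u ^ 2 + 17)) - 4 = -96 / (7 * u ^ 2 + 17) := by
    rw [← mul_div_assoc, div_sub' hu]
    ring
  have h₂ : 17 * (4 * (u ^ 2 - 1) / (7 * u ^ 2 + 17)) + 4 = 96 * u ^ 2 / (7 * u ^ 2 + 17) := by
    rw [← mul_div_assoc, div_add' _ _ _ hu]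
    ring
  rw [h₁, h₂, div_mul_div_comm, div_pow, ← neg_div]
  ring

/-- If `-(7t - 4)(17t + 4) = w²`, then `-64(1+t)²(7t-4)(17t+4)/(1+4t)²` is the `X`-coordinate of
a rational point on the Elkies K3 surface. -/
lemma elkies_point_of_sq {K : Type*} [Field K] (t w : K)
    (hw : w ^ 2 = -((7 * t - 4) * (17 * t + 4))) :
    let A := 65536 * t ^ 4 - 17472 * t ^ 3 - 10176 * t ^ 2 + 18672 * t - 3535
    let B := 1024 * (t + 1) ^ 2 * (15 * t - 8) ^ 2 * (31 * t - 7) ^ 2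
    let x := -64 * (1 + t) ^ 2 * (7 * t - 4) * (17 * t + 4) / (1 + 4 * t) ^ 2
    (8 * w * (1 + t) ^ 2 *
      (220672 * t ^ 4 - 64704 * t ^ 3 - 43296 * t ^ 2 - 408 * t + 800) / (1 + 4 * t) ^ 3) ^ 2 =
      x ^ 3 + A * x ^ 2 + B * x := by
  intro A B x
  simp only [A, B, x]
  by_cases hd : 1 + 4 * t = 0
  · simp [hd]
  · rw [div_pow, mul_pow, mul_pow, mul_pow, hw]
    field_simp
    ring


open RatFunc in
/-- With `t = 4(u² − 1)/(7u² + 17) ∈ ℚ(u)`, the element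
`X₅ = −64(1+t)²(7t−4)(17t+4)/(1+4t)²` is the X-coordinate of a `ℚ(u)`-rational point on the
curve `Y² = X³ + A(t)X² + B(t)X`, where `A(t) = 65536t⁴ − 17472t³ − 10176t² + 18672t − 3535`
and `B(t) = 1024(t+1)²(15t−8)²(31t−7)²`. -/
theorem statement_8 :
    let t : RatFunc ℚ := 4 * (X ^ 2 - 1) / (7 * X ^ 2 + 17)
    let A : RatFunc ℚ := 65536 * t ^ 4 - 17472 * t ^ 3 - 10176 * t ^ 2 + 18672 * t - 3535
    let B : RatFunc ℚ := 1024 * (t + 1) ^ 2 * (15 * t - 8) ^ 2 * (31 * t - 7) ^ 2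
    let x : RatFunc ℚ :=
      -64 * (1 + t) ^ 2 * (7 * t - 4) * (17 * t + 4) / (1 + 4 * t) ^ 2
    ∃ Y : RatFunc ℚ, Y ^ 2 = x ^ 3 + A * x ^ 2 + B * x := by
  intro t A B x
  exact ⟨_, elkies_point_of_sq t (96 * X / (7 * X ^ 2 + 17))
    (sq_eq_of_conic_parametrization X seven_mul_X_sq_add_seventeen_ne_zero)⟩
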